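/- arXiv:2212.13658 — 5 statements merged into one kernel-verified Lean document; each statement's English description precedes it below -/
import Mathlib

section
/- Let d ≥ 1 and let ℓ : [0,∞) → [0,∞) satisfy (A1,i): ℓ(0) = 0 and ℓ(ru) ≥ rℓ(u) for all r ∈ (0,1), u > 0. Let P₀, P₁ be Borel probability measures on ℝ^d with bounded supports. Then for every r ≥ sup{|x₀−x₁| : x₀ ∈ supp(P₀), x₁ ∈ supp(P₁)} with r > 0, V(P₀,P₁;{δ_r}) = (ℓ(r)/r) · T₁(P₀,P₁); and V(P₀,P₁;{δ_M : M > 0}) = C_ℓ · T₁(P₀,P₁), where C_ℓ := lim_{u→∞} ℓ(u)/u. -/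
open MeasureTheory Set Filter
open scoped ENNReal NNReal Classical

noncomputable section

/-- `ℝ^d` with the Euclidean norm. -/
abbrev Vec (d : ℕ) := EuclideanSpace ℝ (Fin d)

/-- essential supremum of `|φ|` on `[0,t]` (`‖φ‖_{∞,t}`), as an extended nonnegative real. -/
def eSupT {d : ℕ} (φ : ℝ → Vec d) (t : ℝ) : ℝ≥0∞ :=
  essSup (fun s => (‖φ s‖₊ : ℝ≥0∞)) (volume.restrict (Icc (0:ℝ) t))

/-- `‖φ‖_∞` on `[0,1]`. -/
def eSup01 {d : ℕ} (φ : ℝ → Vec d) : ℝ≥0∞ := eSupT φ 1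

/-- `N₁(φ)_t`. -/
def N1T {d : ℕ} (φ : ℝ → Vec d) (t : ℝ) : ℝ :=
  if (∫ s in (0:ℝ)..t, φ s) ≠ 0 then t * (eSupT φ t).toReal / ‖∫ s in (0:ℝ)..t, φ s‖ else 1

/-- `N₂(φ)_t`. -/
def N2T {d : ℕ} (φ : ℝ → Vec d) (t : ℝ) : ℝ :=
  if 0 < (∫ s in (0:ℝ)..t, ‖φ s‖) then t * (eSupT φ t).toReal / (∫ s in (0:ℝ)..t, ‖φ s‖) else 1

/-- `N₁(φ) = N₁(φ)₁`. -/
def N1 {d : ℕ} (φ : ℝ → Vec d) : ℝ := N1T φ 1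

/-- `N₂(φ) = N₂(φ)₁`. -/
def N2 {d : ℕ} (φ : ℝ → Vec d) : ℝ := N2T φ 1

/-- the position at time `t` of the absolutely continuous path starting at `ξ`
with velocity `φ`. -/
def pathAt {d : ℕ} (ξ : Vec d) (φ : ℝ → Vec d) (t : ℝ) : Vec d := ξ + ∫ s in (0:ℝ)..t, φ s

/-- the endpoint `X(1)` of the path starting at `ξ` with velocity `φ`. -/
def endPt {d : ℕ} (ξ : Vec d) (φ : ℝ → Vec d) : Vec d := ξ + ∫ s in (0:ℝ)..1, φ s

/-- The Monge–Kantorovich cost `T(P₀,P₁) = inf E[L(X₁ - X₀)]`, the infimum being over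
pairs of random variables, on some probability space, with laws `P₀` and `P₁`. -/
def MKcost {d : ℕ} (L : Vec d → ℝ) (P₀ P₁ : Measure (Vec d)) : ℝ≥0∞ :=
  sInf { c | ∃ (Ω : Type) (_ : MeasureSpace Ω), IsProbabilityMeasure (volume : Measure Ω) ∧
    ∃ (X₀ X₁ : Ω → Vec d), Measurable X₀ ∧ Measurable X₁ ∧
      Measure.map X₀ volume = P₀ ∧ Measure.map X₁ volume = P₁ ∧
      c = ∫⁻ ω, ENNReal.ofReal (L (X₁ ω - X₀ ω)) }

/-- `(X₀, X₁)` is a minimizer of `T(P₀,P₁)`. -/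
def IsTMin {d : ℕ} (L : Vec d → ℝ) (P₀ P₁ : Measure (Vec d)) (Ω : Type) [MeasureSpace Ω]
    (X₀ X₁ : Ω → Vec d) : Prop :=
  IsProbabilityMeasure (volume : Measure Ω) ∧ Measurable X₀ ∧ Measurable X₁ ∧
  Measure.map X₀ volume = P₀ ∧ Measure.map X₁ volume = P₁ ∧
  (∫⁻ ω, ENNReal.ofReal (L (X₁ ω - X₀ ω))) = MKcost L P₀ P₁

/-- The stochastic process determined by the (measurable) initial point `ξ` and velocity
process `φ`, namely `X(ω,t) = ξ ω + ∫₀ᵗ φ(ω,s) ds`, is a member of `𝒜_∞(P₀,P₁)`: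
its paths are a.s. absolutely continuous with essentially bounded derivative and
`X(0), X(1)` have laws `P₀, P₁`. -/
def IsAdmissible {d : ℕ} (P₀ P₁ : Measure (Vec d)) (Ω : Type) [MeasureSpace Ω]
    (ξ : Ω → Vec d) (φ : Ω → ℝ → Vec d) : Prop :=
  IsProbabilityMeasure (volume : Measure Ω) ∧ Measurable ξ ∧ Measurable (Function.uncurry φ) ∧
  (∀ᵐ ω ∂(volume : Measure Ω), eSup01 (φ ω) < ⊤) ∧
  Measure.map ξ volume = P₀ ∧ Measure.map (fun ω => endPt (ξ ω) (φ ω)) volume = P₁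

/-- `∫₀¹ Lᵢ(t, φ) dt` where `Lᵢ(t,φ) = Nᵢ(φ) ℓ(|φ(t)|/Nᵢ(φ))`; `N` is `N₁` or `N₂`. -/
def pathCost {d : ℕ} (ℓ : ℝ → ℝ) (N : (ℝ → Vec d) → ℝ) (φ : ℝ → Vec d) : ℝ≥0∞ :=
  ∫⁻ t in Icc (0:ℝ) 1, ENNReal.ofReal (N φ * ℓ (‖φ t‖ / N φ))

/-- The modified Lagrangian cost `Ṽᵢ(P₀,P₁)`; take `N := N₁` resp. `N := N₂`. -/
def Vtilde {d : ℕ} (ℓ : ℝ → ℝ) (N : (ℝ → Vec d) → ℝ) (P₀ P₁ : Measure (Vec d)) : ℝ≥0∞ :=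
  sInf { c | ∃ (Ω : Type) (_ : MeasureSpace Ω) (ξ : Ω → Vec d) (φ : Ω → ℝ → Vec d),
    IsAdmissible P₀ P₁ Ω ξ φ ∧ c = ∫⁻ ω, pathCost ℓ N (φ ω) }

/-- `X(·)` (given by start `ξ` and velocity `φ`) is a minimizer of `Ṽᵢ(P₀,P₁)`. -/
def IsVtildeMin {d : ℕ} (ℓ : ℝ → ℝ) (N : (ℝ → Vec d) → ℝ) (P₀ P₁ : Measure (Vec d))
    (Ω : Type) [MeasureSpace Ω] (ξ : Ω → Vec d) (φ : Ω → ℝ → Vec d) : Prop :=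
  IsAdmissible P₀ P₁ Ω ξ φ ∧ (∫⁻ ω, pathCost ℓ N (φ ω)) = Vtilde ℓ N P₀ P₁

/-- `X(t;x,y,A) = x + (|A∩[0,t]|/|A|)(y-x)` if `x ≠ y` and `|A| > 0`, else `x`
(for `A ⊆ [0,1]`). -/
def XPath {d : ℕ} (x y : Vec d) (A : Set ℝ) (t : ℝ) : Vec d :=
  if x ≠ y ∧ 0 < volume A then
    x + (((volume (A ∩ Icc (0:ℝ) t)).toReal) / ((volume A).toReal)) • (y - x)
  else x

/-- the velocity (a.e. derivative) of `t ↦ X(t;x,y,A)` (for `A ⊆ [0,1]`). -/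
def XVel {d : ℕ} (x y : Vec d) (A : Set ℝ) (s : ℝ) : Vec d :=
  if x ≠ y ∧ 0 < volume A then
    (if s ∈ A then ((volume A).toReal)⁻¹ • (y - x) else 0)
  else 0

/-- `A : Ω → Set ℝ` is a random measurable subset of `[0,1]`. -/
def IsRandomSet (Ω : Type) [MeasureSpace Ω] (A : Ω → Set ℝ) : Prop :=
  (∀ ω, A ω ⊆ Icc (0:ℝ) 1) ∧ MeasurableSet {p : Ω × ℝ | p.2 ∈ A p.1}

/-- `V(P₀,P₁;B)`: the value of the stochastic optimal transport over pairs `(X,M)` with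
`X ∈ 𝒜_∞(P₀,P₁)`, `M` a nonnegative random variable with law in `B` and `‖X'‖_∞ ≤ M` a.s. -/
def Vval {d : ℕ} (ℓ : ℝ → ℝ) (P₀ P₁ : Measure (Vec d)) (B : Set (Measure ℝ)) : ℝ≥0∞ :=
  sInf { c | ∃ (Ω : Type) (_ : MeasureSpace Ω), IsProbabilityMeasure (volume : Measure Ω) ∧
    ∃ (ξ : Ω → Vec d) (φ : Ω → ℝ → Vec d) (M : Ω → ℝ),
      Measurable ξ ∧ Measurable (Function.uncurry φ) ∧ Measurable M ∧
      (∀ᵐ ω ∂(volume : Measure Ω), 0 ≤ M ω) ∧ Measure.map M volume ∈ B ∧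
      (∀ᵐ ω ∂(volume : Measure Ω), eSup01 (φ ω) ≤ ENNReal.ofReal (M ω)) ∧
      Measure.map ξ volume = P₀ ∧ Measure.map (fun ω => endPt (ξ ω) (φ ω)) volume = P₁ ∧
      c = ∫⁻ ω, ∫⁻ t in Icc (0:ℝ) 1, ENNReal.ofReal (ℓ ‖φ ω t‖) }

/-- `T^V(P₀,P₁;B) = inf E[ℓ(M) M⁻¹ |X₁-X₀| ; M > 0]` over `(X₀,X₁,M) ∈ Π_∞(P₀,P₁;B)`. -/
def TVval {d : ℕ} (ℓ : ℝ → ℝ) (P₀ P₁ : Measure (Vec d)) (B : Set (Measure ℝ)) : ℝ≥0∞ :=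
  sInf { c | ∃ (Ω : Type) (_ : MeasureSpace Ω), IsProbabilityMeasure (volume : Measure Ω) ∧
    ∃ (X₀ X₁ : Ω → Vec d) (M : Ω → ℝ),
      Measurable X₀ ∧ Measurable X₁ ∧ Measurable M ∧
      (∀ᵐ ω ∂(volume : Measure Ω), 0 ≤ M ω) ∧ Measure.map M volume ∈ B ∧
      (∀ᵐ ω ∂(volume : Measure Ω), ‖X₁ ω - X₀ ω‖ ≤ M ω) ∧
      Measure.map X₀ volume = P₀ ∧ Measure.map X₁ volume = P₁ ∧
      c = ∫⁻ ω in {ω | 0 < M ω}, ENNReal.ofReal (ℓ (M ω) / M ω * ‖X₁ ω - X₀ ω‖) }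

/-- `((ξ,φ), M)` is an admissible pair for `V(P₀,P₁;B)`. -/
def IsVvalAdmissible {d : ℕ} (P₀ P₁ : Measure (Vec d)) (B : Set (Measure ℝ)) (Ω : Type)
    [MeasureSpace Ω] (ξ : Ω → Vec d) (φ : Ω → ℝ → Vec d) (M : Ω → ℝ) : Prop :=
  IsProbabilityMeasure (volume : Measure Ω) ∧
  Measurable ξ ∧ Measurable (Function.uncurry φ) ∧ Measurable M ∧
  (∀ᵐ ω ∂(volume : Measure Ω), 0 ≤ M ω) ∧ Measure.map M volume ∈ B ∧
  (∀ᵐ ω ∂(volume : Measure Ω), eSup01 (φ ω) ≤ ENNReal.ofReal (M ω)) ∧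
  Measure.map ξ volume = P₀ ∧ Measure.map (fun ω => endPt (ξ ω) (φ ω)) volume = P₁

/-- `((ξ,φ), M)` is a minimizer of `V(P₀,P₁;B)`. -/
def IsVvalMin {d : ℕ} (ℓ : ℝ → ℝ) (P₀ P₁ : Measure (Vec d)) (B : Set (Measure ℝ)) (Ω : Type)
    [MeasureSpace Ω] (ξ : Ω → Vec d) (φ : Ω → ℝ → Vec d) (M : Ω → ℝ) : Prop :=
  IsVvalAdmissible P₀ P₁ B Ω ξ φ M ∧
  (∫⁻ ω, ∫⁻ t in Icc (0:ℝ) 1, ENNReal.ofReal (ℓ ‖φ ω t‖)) = Vval ℓ P₀ P₁ B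

/-- `(X₀,X₁,M)` is an admissible triplet in `Π_∞(P₀,P₁;B)`. -/
def IsTVAdmissible {d : ℕ} (P₀ P₁ : Measure (Vec d)) (B : Set (Measure ℝ)) (Ω : Type)
    [MeasureSpace Ω] (X₀ X₁ : Ω → Vec d) (M : Ω → ℝ) : Prop :=
  IsProbabilityMeasure (volume : Measure Ω) ∧ Measurable X₀ ∧ Measurable X₁ ∧ Measurable M ∧
  (∀ᵐ ω ∂(volume : Measure Ω), 0 ≤ M ω) ∧ Measure.map M volume ∈ B ∧
  (∀ᵐ ω ∂(volume : Measure Ω), ‖X₁ ω - X₀ ω‖ ≤ M ω) ∧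
  Measure.map X₀ volume = P₀ ∧ Measure.map X₁ volume = P₁

/-- `(X₀,X₁,M)` is a minimizer of `T^V(P₀,P₁;B)`. -/
def IsTVMin {d : ℕ} (ℓ : ℝ → ℝ) (P₀ P₁ : Measure (Vec d)) (B : Set (Measure ℝ)) (Ω : Type)
    [MeasureSpace Ω] (X₀ X₁ : Ω → Vec d) (M : Ω → ℝ) : Prop :=
  IsTVAdmissible P₀ P₁ B Ω X₀ X₁ M ∧
  (∫⁻ ω in {ω | 0 < M ω}, ENNReal.ofReal (ℓ (M ω) / M ω * ‖X₁ ω - X₀ ω‖)) = TVval ℓ P₀ P₁ B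


/-- the unconstrained value `inf{E[∫₀¹ ℓ(|X'(t)|) dt] : X ∈ 𝒜_∞(P₀,P₁)}`. -/
def VInfPlain {d : ℕ} (ℓ : ℝ → ℝ) (P₀ P₁ : Measure (Vec d)) : ℝ≥0∞ :=
  sInf { c | ∃ (Ω : Type) (_ : MeasureSpace Ω) (ξ : Ω → Vec d) (φ : Ω → ℝ → Vec d),
    IsAdmissible P₀ P₁ Ω ξ φ ∧ c = ∫⁻ ω, ∫⁻ t in Icc (0:ℝ) 1, ENNReal.ofReal (ℓ ‖φ ω t‖) }

/-- the value `V(P₀,P₁) = inf{E[∫₀¹ L(X'(t)) dt] : X ∈ 𝒜(P₀,P₁)}`, over stochastic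
processes with a.s. absolutely continuous (integrable derivative) paths. -/
def Vplain {d : ℕ} (L : Vec d → ℝ) (P₀ P₁ : Measure (Vec d)) : ℝ≥0∞ :=
  sInf { c | ∃ (Ω : Type) (_ : MeasureSpace Ω), IsProbabilityMeasure (volume : Measure Ω) ∧
    ∃ (ξ : Ω → Vec d) (φ : Ω → ℝ → Vec d),
      Measurable ξ ∧ Measurable (Function.uncurry φ) ∧
      (∀ᵐ ω ∂(volume : Measure Ω), IntegrableOn (φ ω) (Icc (0:ℝ) 1)) ∧
      Measure.map ξ volume = P₀ ∧ Measure.map (fun ω => endPt (ξ ω) (φ ω)) volume = P₁ ∧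
      c = ∫⁻ ω, ∫⁻ t in Icc (0:ℝ) 1, ENNReal.ofReal (L (φ ω t)) }

/-- the (topological) support of a Borel measure on `ℝ^d`. -/
def msupport {d : ℕ} (μ : Measure (Vec d)) : Set (Vec d) :=
  {x | ∀ ε : ℝ, 0 < ε → 0 < μ (Metric.ball x ε)}

end

/-- bang-bang velocity: move at speed `r` along `Δ` until displacement `Δ` is reached. -/
noncomputable def bbVel {d : ℕ} (r : ℝ) (Δ : Vec d) (t : ℝ) : Vec d :=
  if t ≤ ‖Δ‖ / r then (r / ‖Δ‖) • Δ else 0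

lemma bbVel_measurable {d : ℕ} (r : ℝ) :
    Measurable (fun p : Vec d × ℝ => bbVel r p.1 p.2) := by
  unfold bbVel
  refine Measurable.ite ?_ ?_ measurable_const
  · exact measurableSet_le measurable_snd (by fun_prop)
  · fun_prop

lemma bbVel_norm_le {d : ℕ} {r : ℝ} (hr : 0 < r) (Δ : Vec d) (t : ℝ) : ‖bbVel r Δ t‖ ≤ r := by
  unfold bbVel
  split_ifs
  · rcases eq_or_ne Δ 0 with rfl | h
    · simpa using hr.le
    · have : 0 < ‖Δ‖ := norm_pos_iff.2 h
      rw [norm_smul, norm_div, norm_norm, Real.norm_of_nonneg hr.le]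
      exact (div_mul_cancel₀ _ this.ne').le
  · simpa using hr.le

lemma bbVel_integral {d : ℕ} {r : ℝ} (hr : 0 < r) (Δ : Vec d) (h : ‖Δ‖ ≤ r) :
    ∫ s in (0:ℝ)..1, bbVel r Δ s = Δ := by
  have h0 : 0 ≤ ‖Δ‖ / r := by positivity
  have h1 : ‖Δ‖ / r ≤ 1 := (div_le_one hr).2 h
  have e : bbVel r Δ = (Iic (‖Δ‖ / r)).indicator (fun _ => (r / ‖Δ‖) • Δ) := by
    ext1 t; simp [bbVel, indicator]
  have e2 : Ioc (0:ℝ) 1 ∩ Iic (‖Δ‖ / r) = Ioc 0 (‖Δ‖ / r) := by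
    ext t; simp only [mem_inter_iff, mem_Ioc, mem_Iic]
    constructor
    · rintro ⟨⟨a, b⟩, c⟩; exact ⟨a, c⟩
    · rintro ⟨a, b⟩; exact ⟨⟨a, b.trans h1⟩, b⟩
  rw [intervalIntegral.integral_of_le zero_le_one, e, setIntegral_indicator measurableSet_Iic, e2,
    setIntegral_const]
  simp only [Measure.real, Real.volume_Ioc, sub_zero, ENNReal.toReal_ofReal h0]
  rcases eq_or_ne Δ 0 with rfl | h
  · simp
  · have : 0 < ‖Δ‖ := norm_pos_iff.2 h
    rw [smul_smul]
    have : ‖Δ‖ / r * (r / ‖Δ‖) = 1 := by field_simp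
    rw [this, one_smul]

lemma bbVel_cost {d : ℕ} (ℓ : ℝ → ℝ) (hℓ0 : ℓ 0 = 0) (hℓnn : ∀ u : ℝ, 0 ≤ u → 0 ≤ ℓ u)
    {r : ℝ} (hr : 0 < r) (Δ : Vec d) :
    ∫⁻ t in Icc (0:ℝ) 1, ENNReal.ofReal (ℓ ‖bbVel r Δ t‖)
      ≤ ENNReal.ofReal (ℓ r / r) * ENNReal.ofReal ‖Δ‖ := by
  rcases eq_or_ne Δ 0 with rfl | h
  · simp [bbVel, hℓ0]
  have hp : 0 < ‖Δ‖ := norm_pos_iff.2 h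
  have hrr := hℓnn r hr.le
  have e : ∀ t ∈ Icc (0:ℝ) 1, ENNReal.ofReal (ℓ ‖bbVel r Δ t‖)
      ≤ (Icc 0 (‖Δ‖ / r)).indicator (fun _ => ENNReal.ofReal (ℓ r)) t := by
    intro t ht
    unfold bbVel
    split_ifs with h1
    · rw [norm_smul, norm_div, norm_norm, Real.norm_of_nonneg hr.le, div_mul_cancel₀ _ hp.ne',
        indicator_of_mem]
      exact ⟨ht.1, h1⟩
    · simp [hℓ0]
  calc _ ≤ ∫⁻ t in Icc (0:ℝ) 1, (Icc 0 (‖Δ‖ / r)).indicator (fun _ => ENNReal.ofReal (ℓ r)) t :=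
        setLIntegral_mono' measurableSet_Icc e
    _ ≤ ∫⁻ t, (Icc 0 (‖Δ‖ / r)).indicator (fun _ => ENNReal.ofReal (ℓ r)) t :=
        setLIntegral_le_lintegral _ _
    _ = ENNReal.ofReal (ℓ r / r) * ENNReal.ofReal ‖Δ‖ := by
        rw [lintegral_indicator measurableSet_Icc, setLIntegral_const, Real.volume_Icc, sub_zero,
          ← ENNReal.ofReal_mul hrr, ← ENNReal.ofReal_mul (by positivity)]
        congr 1; ring

lemma ae_mem_msupport {d : ℕ} (P : Measure (Vec d)) : ∀ᵐ x ∂P, x ∈ msupport P := by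
  have : msupport P = P.support := by
    ext x
    rw [(Metric.nhds_basis_ball (x := x)).mem_measureSupport]; rfl
  rw [this]
  exact Measure.support_mem_ae

lemma ae_coupling_le {d : ℕ} {P₀ P₁ : Measure (Vec d)} {r : ℝ}
    (hr : ∀ x₀ ∈ msupport P₀, ∀ x₁ ∈ msupport P₁, ‖x₀ - x₁‖ ≤ r)
    {Ω : Type} [MeasureSpace Ω] {X₀ X₁ : Ω → Vec d} (h0 : Measurable X₀) (h1 : Measurable X₁)
    (m0 : Measure.map X₀ volume = P₀) (m1 : Measure.map X₁ volume = P₁) :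
    ∀ᵐ ω ∂(volume : Measure Ω), ‖X₁ ω - X₀ ω‖ ≤ r := by
  have a0 := ae_of_ae_map h0.aemeasurable (m0 ▸ ae_mem_msupport P₀)
  have a1 := ae_of_ae_map h1.aemeasurable (m1 ▸ ae_mem_msupport P₁)
  rw [m0] at a0
  rw [m1] at a1
  filter_upwards [a0, a1] with ω b0 b1
  rw [norm_sub_rev]
  exact hr _ b0 _ b1

lemma MK_lt_top {d : ℕ} {P₀ P₁ : Measure (Vec d)} [IsProbabilityMeasure P₀]
    [IsProbabilityMeasure P₁] {r : ℝ}
    (hr : ∀ x₀ ∈ msupport P₀, ∀ x₁ ∈ msupport P₁, ‖x₀ - x₁‖ ≤ r) :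
    MKcost (fun u : Vec d => ‖u‖) P₀ P₁ < ⊤ := by
  let I : MeasureSpace (Vec d × Vec d) := ⟨P₀.prod P₁⟩
  have hI : IsProbabilityMeasure (@volume _ I) :=
    inferInstanceAs (IsProbabilityMeasure (P₀.prod P₁))
  have m0 : Measure.map Prod.fst (@volume _ I) = P₀ := by
    change Measure.map Prod.fst (P₀.prod P₁) = P₀
    simp [Measure.map_fst_prod]
  have m1 : Measure.map Prod.snd (@volume _ I) = P₁ := by
    change Measure.map Prod.snd (P₀.prod P₁) = P₁
    simp [Measure.map_snd_prod]
  have hae := @ae_coupling_le d P₀ P₁ r hr _ I _ _ measurable_fst measurable_snd m0 m1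
  refine lt_of_le_of_lt (sInf_le ⟨_, I, hI, Prod.fst, Prod.snd, measurable_fst, measurable_snd,
    m0, m1, rfl⟩) ?_
  calc _ ≤ ∫⁻ _, ENNReal.ofReal r ∂(@volume _ I) :=
        lintegral_mono_ae (hae.mono fun ω h => ENNReal.ofReal_le_ofReal h)
    _ < ⊤ := by rw [lintegral_const, measure_univ, mul_one]; exact ENNReal.ofReal_lt_top

lemma Vval_le {d : ℕ} (ℓ : ℝ → ℝ) (hℓ0 : ℓ 0 = 0) (hℓnn : ∀ u : ℝ, 0 ≤ u → 0 ≤ ℓ u)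
    {P₀ P₁ : Measure (Vec d)} [IsProbabilityMeasure P₀]
    [IsProbabilityMeasure P₁] {r : ℝ} (hrpos : 0 < r)
    (hr : ∀ x₀ ∈ msupport P₀, ∀ x₁ ∈ msupport P₁, ‖x₀ - x₁‖ ≤ r) :
    Vval ℓ P₀ P₁ {(Measure.dirac r : Measure ℝ)}
      ≤ ENNReal.ofReal (ℓ r / r) * MKcost (fun u : Vec d => ‖u‖) P₀ P₁ := by
  have hfin := MK_lt_top hr
  unfold MKcost at hfin ⊢
  obtain ⟨c0, hc0, -⟩ := sInf_lt_iff.1 hfin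
  rw [sInf_eq_iInf', ENNReal.mul_iInf' (by simp) (fun _ => ⟨⟨c0, hc0⟩⟩)]
  refine le_iInf ?_
  rintro ⟨c, Ω, I, hI, X₀, X₁, h0, h1, m0, m1, rfl⟩
  have hae := ae_coupling_le hr h0 h1 m0 m1
  have hend : (fun ω => endPt (X₀ ω) (bbVel r (X₁ ω - X₀ ω))) =ᵐ[volume] X₁ := by
    filter_upwards [hae] with ω hω
    simp [endPt, bbVel_integral hrpos _ hω]
  refine le_trans (sInf_le ⟨Ω, I, hI, X₀, fun ω => bbVel r (X₁ ω - X₀ ω), fun _ => r, h0, ?_,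
    measurable_const, ae_of_all _ fun _ => hrpos.le, ?_, ?_, m0, ?_, rfl⟩) ?_
  · exact (bbVel_measurable r).comp
      (((h1.comp measurable_fst).sub (h0.comp measurable_fst)).prodMk measurable_snd)
  · simp [Measure.map_const]
  · refine ae_of_all _ fun ω => essSup_le_of_ae_le _ (ae_of_all _ fun s => ?_)
    beta_reduce
    rw [← enorm_eq_nnnorm, ← ofReal_norm]
    exact ENNReal.ofReal_le_ofReal (bbVel_norm_le hrpos _ _)
  · rw [Measure.map_congr hend, m1]
  · rw [← lintegral_const_mul' _ _ ENNReal.ofReal_ne_top]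
    exact lintegral_mono fun ω => bbVel_cost ℓ hℓ0 hℓnn hrpos _

lemma ratio_anti (ℓ : ℝ → ℝ)
    (hA1i : ∀ r u : ℝ, 0 < r → r < 1 → 0 < u → r * ℓ u ≤ ℓ (r * u))
    {u v : ℝ} (hu : 0 < u) (huv : u ≤ v) : ℓ v / v ≤ ℓ u / u := by
  rcases huv.eq_or_lt with rfl | h
  · exact le_rfl
  have hv : 0 < v := hu.trans h
  have := hA1i (u / v) v (by positivity) ((div_lt_one hv).2 h) hv
  rw [div_mul_cancel₀ _ hv.ne'] at this
  rw [le_div_iff₀ hu]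
  calc _ = u / v * ℓ v := by ring
    _ ≤ _ := this

lemma le_Vval {d : ℕ} (ℓ : ℝ → ℝ) (hℓ0 : ℓ 0 = 0) 
    (hA1i : ∀ r u : ℝ, 0 < r → r < 1 → 0 < u → r * ℓ u ≤ ℓ (r * u))
    {P₀ P₁ : Measure (Vec d)} (B : Set (Measure ℝ)) (k : ℝ)
    (hB : ∀ μ ∈ B, ∃ M : ℝ, 0 < M ∧ μ = Measure.dirac M ∧ k ≤ ℓ M / M) :
    ENNReal.ofReal k * MKcost (fun u : Vec d => ‖u‖) P₀ P₁ ≤ Vval ℓ P₀ P₁ B := by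
  refine le_sInf ?_
  rintro c ⟨Ω, I, hI, ξ, φ, M, hξ, hφ, hM, -, hMB, hle, m0, m1, rfl⟩
  obtain ⟨m, hm, hmd, hk⟩ := hB _ hMB
  have hMm : ∀ᵐ ω ∂(volume : Measure Ω), M ω = m := by
    refine ae_of_ae_map (p := fun x => x = m) hM.aemeasurable ?_
    rw [hmd, ae_dirac_eq]; exact rfl
  have hend : Measurable (fun ω => endPt (ξ ω) (φ ω)) := by
    refine hξ.add ?_
    simp_rw [intervalIntegral.integral_of_le zero_le_one]
    exact (StronglyMeasurable.integral_prod_right (ν := volume.restrict (Ioc (0:ℝ) 1))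
      hφ.stronglyMeasurable).measurable
  have hT : MKcost (fun u : Vec d => ‖u‖) P₀ P₁
      ≤ ∫⁻ ω, ENNReal.ofReal ‖endPt (ξ ω) (φ ω) - ξ ω‖ :=
    sInf_le ⟨Ω, I, hI, ξ, fun ω => endPt (ξ ω) (φ ω), hξ, hend, m0, m1, rfl⟩
  refine (mul_le_mul_right hT _).trans ?_
  rw [← lintegral_const_mul' _ _ ENNReal.ofReal_ne_top]
  refine lintegral_mono_ae ?_
  filter_upwards [hMm, hle] with ω h1 h2
  rw [h1] at h2
  have hb : ∀ᵐ t ∂(volume.restrict (Icc (0:ℝ) 1)), ‖φ ω t‖ ≤ m := by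
    filter_upwards [ENNReal.ae_le_essSup (μ := volume.restrict (Icc (0:ℝ) 1))
      (fun s => (‖φ ω s‖₊ : ℝ≥0∞))] with t ht
    have := ht.trans h2
    rw [← enorm_eq_nnnorm, ← ofReal_norm] at this
    exact (ENNReal.ofReal_le_ofReal_iff hm.le).1 this
  have e1 : ENNReal.ofReal ‖endPt (ξ ω) (φ ω) - ξ ω‖
      ≤ ∫⁻ t in Icc (0:ℝ) 1, ENNReal.ofReal ‖φ ω t‖ := by
    simp only [endPt, add_sub_cancel_left, ofReal_norm]
    rw [intervalIntegral.integral_of_le zero_le_one, ← integral_Icc_eq_integral_Ioc]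
    exact enorm_integral_le_lintegral_enorm _
  refine (mul_le_mul_right e1 _).trans ?_
  rw [← lintegral_const_mul' _ _ ENNReal.ofReal_ne_top]
  refine lintegral_mono_ae ?_
  filter_upwards [hb] with t ht
  rw [← ENNReal.ofReal_mul' (norm_nonneg _)]
  apply ENNReal.ofReal_le_ofReal
  rcases (norm_nonneg (φ ω t)).eq_or_lt with h | h
  · rw [← h, hℓ0, mul_zero]
  · rw [← le_div_iff₀ h]
    exact hk.trans (ratio_anti ℓ hA1i h ht)

/-- Corollary 2.3: under (A1,i), for `P₀, P₁` with bounded supports and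
any `r > 0` with `r ≥ sup{|x₀-x₁| : x₀ ∈ supp P₀, x₁ ∈ supp P₁}`,
`V(P₀,P₁;{δ_r}) = (ℓ(r)/r)·T₁(P₀,P₁)`, and
`V(P₀,P₁;{δ_M : M > 0}) = C_ℓ·T₁(P₀,P₁)` where `C_ℓ = lim_{u→∞} ℓ(u)/u`. -/
theorem statement12 {d : ℕ} (hd : 1 ≤ d) (ℓ : ℝ → ℝ)
    (hℓnn : ∀ u : ℝ, 0 ≤ u → 0 ≤ ℓ u) (hℓ0 : ℓ 0 = 0)
    (hA1i : ∀ r u : ℝ, 0 < r → r < 1 → 0 < u → r * ℓ u ≤ ℓ (r * u))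
    (C : ℝ) (hC : Tendsto (fun u : ℝ => ℓ u / u) atTop (nhds C))
    (P₀ P₁ : Measure (Vec d)) [IsProbabilityMeasure P₀] [IsProbabilityMeasure P₁]
    (hb₀ : Bornology.IsBounded (msupport P₀)) (hb₁ : Bornology.IsBounded (msupport P₁))
    (r : ℝ) (hrpos : 0 < r)
    (hr : ∀ x₀ ∈ msupport P₀, ∀ x₁ ∈ msupport P₁, ‖x₀ - x₁‖ ≤ r) :
    Vval ℓ P₀ P₁ {(Measure.dirac r : Measure ℝ)}
      = ENNReal.ofReal (ℓ r / r) * MKcost (fun u : Vec d => ‖u‖) P₀ P₁ ∧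
    Vval ℓ P₀ P₁ {μ : Measure ℝ | ∃ M : ℝ, 0 < M ∧ μ = Measure.dirac M}
      = ENNReal.ofReal C * MKcost (fun u : Vec d => ‖u‖) P₀ P₁ := by
  have hmain : ∀ R : ℝ, 0 < R → r ≤ R → Vval ℓ P₀ P₁ {(Measure.dirac R : Measure ℝ)}
      ≤ ENNReal.ofReal (ℓ R / R) * MKcost (fun u : Vec d => ‖u‖) P₀ P₁ := fun R hR hrR =>
    Vval_le ℓ hℓ0 hℓnn hR fun x hx y hy => (hr x hx y hy).trans hrR
  refine ⟨le_antisymm (hmain r hrpos le_rfl) (le_Vval ℓ hℓ0 hA1i _ _ ?_), le_antisymm ?_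
    (le_Vval ℓ hℓ0 hA1i _ _ ?_)⟩
  · rintro μ rfl
    exact ⟨r, hrpos, rfl, le_rfl⟩
  · have ht : Tendsto (fun R : ℝ => ENNReal.ofReal (ℓ R / R) *
        MKcost (fun u : Vec d => ‖u‖) P₀ P₁) atTop
        (nhds (ENNReal.ofReal C * MKcost (fun u : Vec d => ‖u‖) P₀ P₁)) :=
      ENNReal.Tendsto.mul_const (ENNReal.tendsto_ofReal hC) (Or.inr (MK_lt_top hr).ne)
    refine ge_of_tendsto ht ?_
    filter_upwards [eventually_ge_atTop r] with R hR
    refine le_trans (sInf_le_sInf ?_) (hmain R (hrpos.trans_le hR) hR)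
    rintro c ⟨Ω, I, hI, ξ, φ, M, h1, h2, h3, h4, h5, h6⟩
    exact ⟨Ω, I, hI, ξ, φ, M, h1, h2, h3, h4, ⟨R, hrpos.trans_le hR, h5⟩, h6⟩
  · rintro μ ⟨M, hM, rfl⟩
    refine ⟨M, hM, rfl, le_of_tendsto hC ?_⟩
    filter_upwards [eventually_ge_atTop M] with u hu
    exact ratio_anti ℓ hA1i hM hu
end

section
/- Let d ≥ 1 and let L : ℝ^d → [0,∞) be convex with L(0) = 0, and let P₀, P₁ be Borel probability measures on ℝ^d such that V(P₀,P₁) is finite. Then for i = 1,2: V(P₀,P₁) = T(P₀,P₁) = inf{E[∫₀¹ (1/Nᵢ(X')) L(Nᵢ(X') X'(t)) dt] : X ∈ A_∞(P₀,P₁)}. -/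
open MeasureTheory Set Filter
open scoped ENNReal NNReal Classical

lemma aux_jensen {d : ℕ} (L : Vec d → ℝ) (hLmeas : Measurable L) (hLnn : ∀ u : Vec d, 0 ≤ L u)
    (hLconv : ConvexOn ℝ Set.univ L) (ψ : ℝ → Vec d) (hm : Measurable ψ)
    (hi : IntegrableOn ψ (Icc (0:ℝ) 1)) :
    ENNReal.ofReal (L (∫ s in (0:ℝ)..1, ψ s))
      ≤ ∫⁻ t in Icc (0:ℝ) 1, ENNReal.ofReal (L (ψ t)) := by
  have hcont : ContinuousOn L Set.univ := hLconv.continuousOn isOpen_univ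
  have : IsProbabilityMeasure (volume.restrict (Icc (0:ℝ) 1)) := ⟨by simp⟩
  by_cases hint : Integrable (fun t => L (ψ t)) (volume.restrict (Icc (0:ℝ) 1))
  · rw [← ofReal_integral_eq_lintegral_ofReal hint (Eventually.of_forall fun t => hLnn _)]
    apply ENNReal.ofReal_le_ofReal
    rw [intervalIntegral.integral_of_le zero_le_one, ← integral_Icc_eq_integral_Ioc]
    exact hLconv.map_integral_le hcont isClosed_univ (by simp) hi hint
  · have : ∫⁻ t in Icc (0:ℝ) 1, ENNReal.ofReal (L (ψ t)) = ⊤ := by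
      by_contra h
      apply hint
      exact (lintegral_ofReal_ne_top_iff_integrable
        (hLmeas.comp hm).aestronglyMeasurable (Eventually.of_forall fun t => hLnn _)).1 h
    rw [this]; exact le_top

lemma aux_scale {d : ℕ} (L : Vec d → ℝ)
    (hLconv : ConvexOn ℝ Set.univ L) (hL0 : L 0 = 0) (N : ℝ) (hN : 1 ≤ N) (u : Vec d) :
    L u ≤ N⁻¹ * L (N • u) := by
  have hp : 0 < N := by linarith
  have h := hLconv.2 (mem_univ (N • u)) (mem_univ (0 : Vec d)) (inv_nonneg.2 hp.le)
    (sub_nonneg.2 (inv_le_one_of_one_le₀ hN)) (by ring)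
  simpa [smul_smul, inv_mul_cancel₀ hp.ne', hL0] using h

lemma aux_bound {d : ℕ} (ψ : ℝ → Vec d) (hb : eSup01 ψ < ⊤) :
    ∀ᵐ s ∂(volume.restrict (Icc (0:ℝ) 1)), ‖ψ s‖ ≤ (eSupT ψ 1).toReal := by
  have h := ENNReal.ae_le_essSup (μ := volume.restrict (Icc (0:ℝ) 1))
    (fun s => (‖ψ s‖₊ : ℝ≥0∞))
  filter_upwards [h] with s hs
  have := ENNReal.toReal_mono hb.ne hs
  simpa [eSup01] using this

lemma aux_integrable {d : ℕ} (ψ : ℝ → Vec d) (hm : Measurable ψ) (hb : eSup01 ψ < ⊤) :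
    IntegrableOn ψ (Icc (0:ℝ) 1) :=
  Measure.integrableOn_of_bounded (by simp) hm.aestronglyMeasurable (aux_bound ψ hb)

lemma aux_normint {d : ℕ} (ψ : ℝ → Vec d) (hm : Measurable ψ) (hb : eSup01 ψ < ⊤) :
    (∫ s in (0:ℝ)..1, ‖ψ s‖) ≤ (eSupT ψ 1).toReal := by
  rw [intervalIntegral.integral_of_le zero_le_one, ← integral_Icc_eq_integral_Ioc]
  have := integral_mono_ae (aux_integrable ψ hm hb).norm
    (integrable_const (eSupT ψ 1).toReal) (aux_bound ψ hb)
  simpa using this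

lemma aux_N1 {d : ℕ} (ψ : ℝ → Vec d) (hm : Measurable ψ) (hb : eSup01 ψ < ⊤) :
    1 ≤ N1 ψ := by
  unfold N1 N1T
  split_ifs with h
  · rw [one_le_div (norm_pos_iff.2 h), one_mul]
    exact (intervalIntegral.norm_integral_le_integral_norm zero_le_one).trans
      (aux_normint ψ hm hb)
  · exact le_rfl

lemma aux_N2 {d : ℕ} (ψ : ℝ → Vec d) (hm : Measurable ψ) (hb : eSup01 ψ < ⊤) :
    1 ≤ N2 ψ := by
  unfold N2 N2T
  split_ifs with h
  · rw [one_le_div h, one_mul]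
    exact aux_normint ψ hm hb
  · exact le_rfl

lemma aux_esup_const {d : ℕ} (v : Vec d) : eSupT (fun _ => v) 1 = (‖v‖₊ : ℝ≥0∞) := by
  unfold eSupT
  apply essSup_const
  intro h
  have := congrArg (fun μ : Measure ℝ => μ univ) h
  simp at this

lemma aux_N1_const {d : ℕ} (v : Vec d) : N1 (fun _ => v) = 1 := by
  unfold N1 N1T
  split_ifs with h
  · rw [aux_esup_const]
    simp at h
    simp [h]
  · rfl

lemma aux_N2_const {d : ℕ} (v : Vec d) : N2 (fun _ => v) = 1 := by
  unfold N2 N2T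
  split_ifs with h
  · rw [aux_esup_const]
    simp at h
    simp [h]
  · rfl

lemma aux_endPt_meas {d : ℕ} {Ω : Type} [MeasureSpace Ω] (ξ : Ω → Vec d) (φ : Ω → ℝ → Vec d)
    (hξ : Measurable ξ) (hφ : Measurable (Function.uncurry φ)) :
    Measurable (fun ω => endPt (ξ ω) (φ ω)) := by
  unfold endPt
  refine hξ.add ?_
  simp only [intervalIntegral.integral_of_le zero_le_one]
  exact (StronglyMeasurable.integral_prod_right
    (ν := volume.restrict (Ioc (0:ℝ) 1)) hφ.stronglyMeasurable).measurable

lemma aux_MK_le {d : ℕ} (L : Vec d → ℝ)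
    (P₀ P₁ : Measure (Vec d)) (Ω : Type) [MeasureSpace Ω]
    (hP : IsProbabilityMeasure (volume : Measure Ω)) (ξ : Ω → Vec d) (φ : Ω → ℝ → Vec d)
    (hξ : Measurable ξ) (hφ : Measurable (Function.uncurry φ))
    (h0 : Measure.map ξ volume = P₀)
    (h1 : Measure.map (fun ω => endPt (ξ ω) (φ ω)) volume = P₁)
    (F : Ω → ℝ≥0∞)
    (hF : ∀ᵐ ω ∂(volume : Measure Ω), ENNReal.ofReal (L (∫ s in (0:ℝ)..1, φ ω s)) ≤ F ω) :
    MKcost L P₀ P₁ ≤ ∫⁻ ω, F ω := by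
  have h : MKcost L P₀ P₁ ≤ ∫⁻ ω, ENNReal.ofReal (L (endPt (ξ ω) (φ ω) - ξ ω)) :=
    sInf_le ⟨Ω, _, hP, ξ, fun ω => endPt (ξ ω) (φ ω), hξ,
      aux_endPt_meas ξ φ hξ hφ, h0, h1, rfl⟩
  refine h.trans ?_
  apply lintegral_mono_ae
  filter_upwards [hF] with ω hω
  simpa [endPt] using hω

lemma aux_modified {d : ℕ} (L : Vec d → ℝ)
    (hLmeas : Measurable L) (hLnn : ∀ u : Vec d, 0 ≤ L u)
    (hLconv : ConvexOn ℝ Set.univ L) (hL0 : L 0 = 0)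
    (P₀ P₁ : Measure (Vec d)) (N : (ℝ → Vec d) → ℝ)
    (hN : ∀ ψ, Measurable ψ → eSup01 ψ < ⊤ → 1 ≤ N ψ)
    (hNc : ∀ v, N (fun _ => v) = 1) :
    MKcost L P₀ P₁
      = sInf { c | ∃ (Ω : Type) (_ : MeasureSpace Ω) (ξ : Ω → Vec d) (φ : Ω → ℝ → Vec d),
          IsAdmissible P₀ P₁ Ω ξ φ ∧
          c = ∫⁻ ω, ∫⁻ t in Icc (0:ℝ) 1,
            ENNReal.ofReal ((N (φ ω))⁻¹ * L (N (φ ω) • φ ω t)) } := by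
  apply le_antisymm
  · apply le_sInf
    rintro c ⟨Ω, _, ξ, φ, ⟨hP, hξ, hφ, hb, h0, h1⟩, rfl⟩
    apply aux_MK_le L P₀ P₁ Ω hP ξ φ hξ hφ h0 h1
    filter_upwards [hb] with ω hω
    have hm : Measurable (φ ω) := hφ.comp measurable_prodMk_left
    refine (aux_jensen L hLmeas hLnn hLconv (φ ω) hm (aux_integrable _ hm hω)).trans ?_
    apply lintegral_mono
    intro t
    exact ENNReal.ofReal_le_ofReal (aux_scale L hLconv hL0 _ (hN _ hm hω) _)
  · apply le_sInf
    rintro c ⟨Ω, _, hP, X₀, X₁, m0, m1, h0, h1, rfl⟩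
    apply sInf_le
    refine ⟨Ω, _, X₀, fun ω _ => X₁ ω - X₀ ω, ⟨hP, m0, ?_, ?_, h0, ?_⟩, ?_⟩
    · exact (m1.sub m0).comp measurable_fst
    · refine Eventually.of_forall fun ω => ?_
      unfold eSup01
      rw [aux_esup_const]
      exact ENNReal.coe_lt_top
    · simpa [endPt] using h1
    · simp [hNc]

/-- (1.9.0416) of the paper: if `L : ℝ^d → [0,∞)` is convex with
`L(0) = 0` and `V(P₀,P₁)` is finite, then for `i = 1,2`,
`V(P₀,P₁) = T(P₀,P₁) = inf{E[∫₀¹ Nᵢ(X')⁻¹ L(Nᵢ(X') X'(t)) dt] : X ∈ 𝒜_∞(P₀,P₁)}`. -/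
theorem statement14 {d : ℕ} (hd : 1 ≤ d) (L : Vec d → ℝ)
    (hLmeas : Measurable L) (hLnn : ∀ u : Vec d, 0 ≤ L u)
    (hLconv : ConvexOn ℝ Set.univ L) (hL0 : L 0 = 0)
    (P₀ P₁ : Measure (Vec d)) [IsProbabilityMeasure P₀] [IsProbabilityMeasure P₁]
    (hfin : Vplain L P₀ P₁ < ⊤) :
    Vplain L P₀ P₁ = MKcost L P₀ P₁ ∧
    MKcost L P₀ P₁
      = sInf { c | ∃ (Ω : Type) (_ : MeasureSpace Ω) (ξ : Ω → Vec d) (φ : Ω → ℝ → Vec d),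
          IsAdmissible P₀ P₁ Ω ξ φ ∧
          c = ∫⁻ ω, ∫⁻ t in Icc (0:ℝ) 1,
            ENNReal.ofReal ((N1 (φ ω))⁻¹ * L (N1 (φ ω) • φ ω t)) } ∧
    MKcost L P₀ P₁
      = sInf { c | ∃ (Ω : Type) (_ : MeasureSpace Ω) (ξ : Ω → Vec d) (φ : Ω → ℝ → Vec d),
          IsAdmissible P₀ P₁ Ω ξ φ ∧
          c = ∫⁻ ω, ∫⁻ t in Icc (0:ℝ) 1,
            ENNReal.ofReal ((N2 (φ ω))⁻¹ * L (N2 (φ ω) • φ ω t)) } := by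
  refine ⟨?_, aux_modified L hLmeas hLnn hLconv hL0 P₀ P₁ N1 aux_N1 aux_N1_const,
    aux_modified L hLmeas hLnn hLconv hL0 P₀ P₁ N2 aux_N2 aux_N2_const⟩
  apply le_antisymm
  · apply le_sInf
    rintro c ⟨Ω, _, hP, X₀, X₁, m0, m1, h0, h1, rfl⟩
    apply sInf_le
    refine ⟨Ω, _, hP, X₀, fun ω _ => X₁ ω - X₀ ω, m0, ?_, ?_, h0, ?_, ?_⟩
    · exact (m1.sub m0).comp measurable_fst
    · exact Eventually.of_forall fun ω => integrableOn_const (by simp)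
    · simpa [endPt] using h1
    · simp
  · apply le_sInf
    rintro c ⟨Ω, _, hP, ξ, φ, hξ, hφ, hi, h0, h1, rfl⟩
    apply aux_MK_le L P₀ P₁ Ω hP ξ φ hξ hφ h0 h1
    filter_upwards [hi] with ω hω
    have hm : Measurable (φ ω) := hφ.comp measurable_prodMk_left
    exact aux_jensen L hLmeas hLnn hLconv (φ ω) hm hω
end

section
/- Let d ≥ 1, let ℓ : [0,∞) → [0,∞) with ℓ(0) = 0, and fix i ∈ {1,2}. For any Borel probability measures P₀, P₁ on ℝ^d, Ṽᵢ(P₀,P₁) = inf{E[∫₀^τ ℓ(|X'(t)|)dt]}, where the infimum on the right is over random times τ = τ(ω) ≥ 1 and processes X(·) with paths in AC([0,τ];ℝ^d) such that Nᵢ(X')_τ = τ almost surely and (X(0), X(τ)) ∈ Π(P₀,P₁). -/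
open MeasureTheory Set Filter
open scoped ENNReal NNReal Classical

/-- time rescaling of a velocity -/
def scl {d : ℕ} (c : ℝ) (φ : ℝ → Vec d) : ℝ → Vec d := fun s => c • φ (c * s)

lemma map_restrict_scl {c : ℝ} (hc : 0 < c) (t : ℝ) :
    Measure.map (c * ·) ((volume : Measure ℝ).restrict (Icc 0 t)) =
      ENNReal.ofReal c⁻¹ • (volume : Measure ℝ).restrict (Icc 0 (c * t)) := by
  have h1 : (c * ·) ⁻¹' (Icc (0:ℝ) (c * t)) = Icc 0 t := by
    ext x
    simp only [mem_preimage, mem_Icc]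
    constructor
    · rintro ⟨h1, h2⟩
      exact ⟨nonneg_of_mul_nonneg_right h1 hc, le_of_mul_le_mul_left h2 hc⟩
    · rintro ⟨h1, h2⟩
      exact ⟨mul_nonneg hc.le h1, mul_le_mul_of_nonneg_left h2 hc.le⟩
  rw [← h1, ← Measure.restrict_map (measurable_const_mul c) measurableSet_Icc,
    Real.map_volume_mul_left hc.ne', abs_of_pos (inv_pos.2 hc), Measure.restrict_smul]

lemma lintegral_scl {c : ℝ} (hc : 0 < c) (t : ℝ) (g : ℝ → ℝ≥0∞) :
    ∫⁻ s in Icc (0:ℝ) t, g (c * s) =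
      ENNReal.ofReal c⁻¹ * ∫⁻ s in Icc (0:ℝ) (c * t), g s := by
  have he : MeasurableEmbedding (c * · : ℝ → ℝ) := (Homeomorph.mulLeft₀ c hc.ne').measurableEmbedding
  rw [← he.lintegral_map, map_restrict_scl hc, lintegral_smul_measure, smul_eq_mul]

lemma eSupT_scl {d : ℕ} {c : ℝ} (hc : 0 < c) (φ : ℝ → Vec d) (t : ℝ) :
    eSupT (scl c φ) t = ENNReal.ofReal c * eSupT φ (c * t) := by
  have he : MeasurableEmbedding (c * · : ℝ → ℝ) := (Homeomorph.mulLeft₀ c hc.ne').measurableEmbedding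
  have h := he.essSup_map_measure (μ := (volume : Measure ℝ).restrict (Icc 0 t))
    (g := fun s => (‖φ s‖₊ : ℝ≥0∞))
  have h0 : ENNReal.ofReal c⁻¹ ≠ 0 := by simpa using hc
  rw [map_restrict_scl hc, essSup, Measure.ae_ennreal_smul_measure_eq h0, ← essSup] at h
  unfold eSupT
  rw [h, ← ENNReal.essSup_const_mul]
  congr 1
  ext s
  simp only [scl, Function.comp, nnnorm_smul, ENNReal.coe_mul]
  congr 1
  rw [ENNReal.ofReal, ENNReal.coe_inj]
  ext
  simp [hc.le]

lemma integral_scl {d : ℕ} (c : ℝ) (φ : ℝ → Vec d) (t : ℝ) :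
    ∫ s in (0:ℝ)..t, scl c φ s = ∫ s in (0:ℝ)..(c * t), φ s := by
  have := intervalIntegral.smul_integral_comp_mul_left (a := 0) (b := t) φ c
  simp only [scl]
  rw [intervalIntegral.integral_smul, this, mul_zero]

lemma integral_norm_scl {d : ℕ} {c : ℝ} (hc : 0 < c) (φ : ℝ → Vec d) (t : ℝ) :
    ∫ s in (0:ℝ)..t, ‖scl c φ s‖ = ∫ s in (0:ℝ)..(c * t), ‖φ s‖ := by
  have := intervalIntegral.smul_integral_comp_mul_left (a := 0) (b := t) (fun s => ‖φ s‖) c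
  simp only [scl, norm_smul, Real.norm_eq_abs, abs_of_pos hc]
  rw [intervalIntegral.integral_const_mul, ← smul_eq_mul, this, mul_zero]

lemma N1T_scl {d : ℕ} {c : ℝ} (hc : 0 < c) (φ : ℝ → Vec d) (t : ℝ) :
    N1T (scl c φ) t = N1T φ (c * t) := by
  unfold N1T
  rw [integral_scl, eSupT_scl hc, ENNReal.toReal_mul, ENNReal.toReal_ofReal hc.le,
    ← mul_assoc, mul_comm t c]

lemma N2T_scl {d : ℕ} {c : ℝ} (hc : 0 < c) (φ : ℝ → Vec d) (t : ℝ) :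
    N2T (scl c φ) t = N2T φ (c * t) := by
  unfold N2T
  rw [integral_norm_scl hc, eSupT_scl hc, ENNReal.toReal_mul, ENNReal.toReal_ofReal hc.le,
    ← mul_assoc, mul_comm t c]

lemma ae_norm_le {d : ℕ} {φ : ℝ → Vec d} (h : eSupT φ 1 < ⊤) :
    ∀ᵐ s, s ∈ uIoc (0:ℝ) 1 → ‖φ s‖ ≤ (eSupT φ 1).toReal := by
  have h1 := ENNReal.ae_le_essSup (μ := (volume : Measure ℝ).restrict (Icc 0 1))
    (fun s => (‖φ s‖₊ : ℝ≥0∞))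
  rw [ae_restrict_iff' measurableSet_Icc] at h1
  filter_upwards [h1] with s hs hs'
  rw [uIoc_of_le zero_le_one] at hs'
  have := ENNReal.toReal_mono h.ne (hs (Ioc_subset_Icc_self hs'))
  simpa using this

lemma N1T_ge {d : ℕ} {φ : ℝ → Vec d} (h : eSupT φ 1 < ⊤) : 1 ≤ N1T φ 1 := by
  unfold N1T
  split_ifs with hne
  · rw [le_div_iff₀ (norm_pos_iff.2 hne)]
    have := intervalIntegral.norm_integral_le_of_norm_le_const_ae (ae_norm_le h)
    simpa using this
  · exact le_rfl

lemma N2T_ge {d : ℕ} {φ : ℝ → Vec d} (h : eSupT φ 1 < ⊤) : 1 ≤ N2T φ 1 := by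
  unfold N2T
  split_ifs with hne
  · rw [le_div_iff₀ hne]
    have := intervalIntegral.norm_integral_le_of_norm_le_const_ae (f := fun s => ‖φ s‖)
      (a := 0) (b := 1) (C := (eSupT φ 1).toReal) (by simpa using ae_norm_le h)
    rw [Real.norm_eq_abs, abs_of_pos hne] at this
    simpa using this
  · exact le_rfl

lemma measurable_eSupT {d : ℕ} {Ω : Type} [MeasurableSpace Ω] {φ : Ω → ℝ → Vec d}
    (hφ : Measurable (Function.uncurry φ)) : Measurable (fun ω => eSupT (φ ω) 1) := by
  refine measurable_of_Iic fun a => ?_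
  have : (fun ω => eSupT (φ ω) 1) ⁻¹' Iic a =
      {ω | (volume : Measure ℝ).restrict (Icc 0 1)
        (Prod.mk ω ⁻¹' {p : Ω × ℝ | a < (‖Function.uncurry φ p‖₊ : ℝ≥0∞)}) = 0} := by
    ext ω
    simp only [mem_preimage, mem_Iic, mem_setOf_eq]
    constructor
    · intro h
      have h1 := ENNReal.ae_le_essSup (μ := (volume : Measure ℝ).restrict (Icc 0 1))
        (fun s => (‖φ ω s‖₊ : ℝ≥0∞))
      have h2 : ∀ᵐ s ∂((volume : Measure ℝ).restrict (Icc 0 1)), (‖φ ω s‖₊ : ℝ≥0∞) ≤ a := by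
        filter_upwards [h1] with s hs using hs.trans h
      rw [ae_iff] at h2
      simp only [not_le] at h2
      exact h2
    · intro h
      refine essSup_le_of_ae_le a ?_
      change ∀ᵐ s ∂_, _ ≤ a
      rw [ae_iff]
      simp only [not_le]
      exact h
  rw [this]
  refine measurable_measure_prodMk_left ?_ (measurableSet_singleton 0)
  exact measurableSet_lt measurable_const hφ.nnnorm.coe_nnreal_ennreal

lemma measurable_int {E : Type} [NormedAddCommGroup E] [NormedSpace ℝ E] [MeasurableSpace E]
    [BorelSpace E] [SecondCountableTopology E]
    {Ω : Type} [MeasurableSpace Ω] {φ : Ω → ℝ → E}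
    (hφ : Measurable (Function.uncurry φ)) : Measurable (fun ω => ∫ s in (0:ℝ)..1, φ ω s) := by
  simp only [intervalIntegral.integral_of_le zero_le_one]
  exact (hφ.stronglyMeasurable.integral_prod_right).measurable

lemma measurable_N1T {d : ℕ} {Ω : Type} [MeasurableSpace Ω] {φ : Ω → ℝ → Vec d}
    (hφ : Measurable (Function.uncurry φ)) : Measurable (fun ω => N1T (φ ω) 1) := by
  unfold N1T
  have h1 := measurable_int hφ
  have h2 := (measurable_eSupT hφ).ennreal_toReal
  refine Measurable.ite ?_ ((h2.const_mul 1).div h1.norm) measurable_const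
  exact (measurableSet_eq_fun h1 measurable_const).compl

lemma measurable_N2T {d : ℕ} {Ω : Type} [MeasurableSpace Ω] {φ : Ω → ℝ → Vec d}
    (hφ : Measurable (Function.uncurry φ)) : Measurable (fun ω => N2T (φ ω) 1) := by
  unfold N2T
  have h1 : Measurable fun ω => ∫ s in (0:ℝ)..1, ‖φ ω s‖ :=
    measurable_int (φ := fun ω s => ‖φ ω s‖) hφ.norm
  have h2 := (measurable_eSupT hφ).ennreal_toReal
  refine Measurable.ite ?_ ((h2.const_mul 1).div h1) measurable_const
  exact measurableSet_lt measurable_const h1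

lemma measurable_scl {d : ℕ} {Ω : Type} [MeasurableSpace Ω] {φ : Ω → ℝ → Vec d}
    (hφ : Measurable (Function.uncurry φ)) {c : Ω → ℝ} (hc : Measurable c) :
    Measurable (Function.uncurry fun ω => scl (c ω) (φ ω)) := by
  have h1 : Measurable fun p : Ω × ℝ => c p.1 := hc.comp measurable_fst
  have h2 : Measurable fun p : Ω × ℝ => (p.1, c p.1 * p.2) :=
    measurable_fst.prodMk (h1.mul measurable_snd)
  exact h1.smul (hφ.comp h2)

theorem generic {d : ℕ} (ℓ : ℝ → ℝ) (NT : (ℝ → Vec d) → ℝ → ℝ)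
    (hscl : ∀ (c : ℝ), 0 < c → ∀ (φ : ℝ → Vec d) (t : ℝ), NT (scl c φ) t = NT φ (c * t))
    (hge : ∀ φ : ℝ → Vec d, eSupT φ 1 < ⊤ → 1 ≤ NT φ 1)
    (hmeas : ∀ (Ω : Type) (_ : MeasurableSpace Ω) (φ : Ω → ℝ → Vec d),
      Measurable (Function.uncurry φ) → Measurable (fun ω => NT (φ ω) 1))
    (P₀ P₁ : Measure (Vec d)) :
    Vtilde ℓ (fun φ => NT φ 1) P₀ P₁
      = sInf { c : ℝ≥0∞ |
        ∃ (Ω : Type) (_ : MeasureSpace Ω), IsProbabilityMeasure (volume : Measure Ω) ∧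
          ∃ (ξ : Ω → Vec d) (φ : Ω → ℝ → Vec d) (τ : Ω → ℝ),
            Measurable ξ ∧ Measurable (Function.uncurry φ) ∧ Measurable τ ∧
            (∀ᵐ ω ∂(volume : Measure Ω), 1 ≤ τ ω) ∧
            (∀ᵐ ω ∂(volume : Measure Ω), eSupT (φ ω) (τ ω) < ⊤) ∧
            (∀ᵐ ω ∂(volume : Measure Ω), NT (φ ω) (τ ω) = τ ω) ∧
            Measure.map ξ volume = P₀ ∧
            Measure.map (fun ω => ξ ω + ∫ s in (0:ℝ)..(τ ω), φ ω s) volume = P₁ ∧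
            c = ∫⁻ ω, ∫⁻ t in Icc (0:ℝ) (τ ω), ENNReal.ofReal (ℓ ‖φ ω t‖) } := by
  unfold Vtilde
  congr 1
  ext c
  constructor
  · rintro ⟨Ω, mΩ, ξ, φ, ⟨hP, hξ, hφ, hS, h0, h1⟩, rfl⟩
    have hN := hmeas Ω _ φ hφ
    have hτ : ∀ᵐ ω ∂(volume : Measure Ω), 1 ≤ NT (φ ω) 1 := by
      filter_upwards [hS] with ω h using hge _ h
    refine ⟨Ω, mΩ, hP, ξ, fun ω => scl (NT (φ ω) 1)⁻¹ (φ ω), fun ω => NT (φ ω) 1, hξ,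
      measurable_scl hφ hN.inv, hN, hτ, ?_, ?_, h0, ?_, ?_⟩
    · filter_upwards [hτ, hS] with ω h hs
      have hp : 0 < NT (φ ω) 1 := by linarith
      rw [eSupT_scl (inv_pos.2 hp), inv_mul_cancel₀ hp.ne']
      exact ENNReal.mul_lt_top ENNReal.ofReal_lt_top hs
    · filter_upwards [hτ] with ω h
      have hp : 0 < NT (φ ω) 1 := by linarith
      rw [hscl _ (inv_pos.2 hp), inv_mul_cancel₀ hp.ne']
    · rw [← h1]
      refine Measure.map_congr ?_
      filter_upwards [hτ] with ω h
      have hp : 0 < NT (φ ω) 1 := by linarith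
      rw [integral_scl, inv_mul_cancel₀ hp.ne', endPt]
    · refine lintegral_congr_ae ?_
      filter_upwards [hτ] with ω h
      have hp : 0 < NT (φ ω) 1 := by linarith
      have hip := inv_pos.2 hp
      have := lintegral_scl hip (NT (φ ω) 1)
        (fun s => ENNReal.ofReal (ℓ (‖φ ω s‖ / NT (φ ω) 1)))
      rw [inv_mul_cancel₀ hp.ne', inv_inv, ← lintegral_const_mul' _ _ ENNReal.ofReal_ne_top] at this
      simp only [pathCost, scl, norm_smul, Real.norm_eq_abs, abs_of_pos hip, ENNReal.ofReal_mul hp.le]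
      rw [← this]
      simp only [div_eq_inv_mul]
  · rintro ⟨Ω, mΩ, hP, ξ, φ, τ, hξ, hφ, hτm, hτ, hS, hN, h0, h1, rfl⟩
    refine ⟨Ω, mΩ, ξ, fun ω => scl (τ ω) (φ ω), ⟨hP, hξ, measurable_scl hφ hτm, ?_, h0, ?_⟩, ?_⟩
    · filter_upwards [hτ, hS] with ω h hs
      rw [eSup01, eSupT_scl (by linarith), mul_one]
      exact ENNReal.mul_lt_top ENNReal.ofReal_lt_top hs
    · simp only [endPt, integral_scl, mul_one]
      exact h1
    · refine lintegral_congr_ae ?_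
      filter_upwards [hτ, hN] with ω h hN
      have hp : 0 < τ ω := by linarith
      have := lintegral_scl hp 1 (fun s => ENNReal.ofReal (ℓ ‖φ ω s‖))
      simp only [pathCost, hscl _ hp, mul_one, hN, scl, norm_smul, Real.norm_eq_abs, abs_of_pos hp,
        ENNReal.ofReal_mul hp.le, mul_div_cancel_left₀ _ hp.ne']
      rw [lintegral_const_mul' _ _ ENNReal.ofReal_ne_top, this, ← mul_assoc,
        ← ENNReal.ofReal_mul hp.le, mul_one, mul_inv_cancel₀ hp.ne', ENNReal.ofReal_one, one_mul]

/-- (1.11.0508) of the paper: for `i = 1, 2`, `Ṽᵢ(P₀,P₁)` equals the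
infimum of `E[∫₀^τ ℓ(|X'(t)|)dt]` over random times `τ ≥ 1` and absolutely continuous
processes `X(·)` on `[0,τ]` with `Nᵢ(X')_τ = τ` a.s. and `(X(0),X(τ))` having laws
`(P₀,P₁)`. -/
theorem statement15 {d : ℕ} (hd : 1 ≤ d) (ℓ : ℝ → ℝ)
    (hℓnn : ∀ u : ℝ, 0 ≤ u → 0 ≤ ℓ u) (hℓ0 : ℓ 0 = 0)
    (P₀ P₁ : Measure (Vec d)) [IsProbabilityMeasure P₀] [IsProbabilityMeasure P₁] :
    (Vtilde ℓ N1 P₀ P₁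
      = sInf { c : ℝ≥0∞ |
        ∃ (Ω : Type) (_ : MeasureSpace Ω), IsProbabilityMeasure (volume : Measure Ω) ∧
          ∃ (ξ : Ω → Vec d) (φ : Ω → ℝ → Vec d) (τ : Ω → ℝ),
            Measurable ξ ∧ Measurable (Function.uncurry φ) ∧ Measurable τ ∧
            (∀ᵐ ω ∂(volume : Measure Ω), 1 ≤ τ ω) ∧
            (∀ᵐ ω ∂(volume : Measure Ω), eSupT (φ ω) (τ ω) < ⊤) ∧
            (∀ᵐ ω ∂(volume : Measure Ω), N1T (φ ω) (τ ω) = τ ω) ∧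
            Measure.map ξ volume = P₀ ∧
            Measure.map (fun ω => ξ ω + ∫ s in (0:ℝ)..(τ ω), φ ω s) volume = P₁ ∧
            c = ∫⁻ ω, ∫⁻ t in Icc (0:ℝ) (τ ω), ENNReal.ofReal (ℓ ‖φ ω t‖) }) ∧
    (Vtilde ℓ N2 P₀ P₁
      = sInf { c : ℝ≥0∞ |
        ∃ (Ω : Type) (_ : MeasureSpace Ω), IsProbabilityMeasure (volume : Measure Ω) ∧
          ∃ (ξ : Ω → Vec d) (φ : Ω → ℝ → Vec d) (τ : Ω → ℝ),
            Measurable ξ ∧ Measurable (Function.uncurry φ) ∧ Measurable τ ∧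
            (∀ᵐ ω ∂(volume : Measure Ω), 1 ≤ τ ω) ∧
            (∀ᵐ ω ∂(volume : Measure Ω), eSupT (φ ω) (τ ω) < ⊤) ∧
            (∀ᵐ ω ∂(volume : Measure Ω), N2T (φ ω) (τ ω) = τ ω) ∧
            Measure.map ξ volume = P₀ ∧
            Measure.map (fun ω => ξ ω + ∫ s in (0:ℝ)..(τ ω), φ ω s) volume = P₁ ∧
            c = ∫⁻ ω, ∫⁻ t in Icc (0:ℝ) (τ ω), ENNReal.ofReal (ℓ ‖φ ω t‖) }) := by
  exact ⟨generic ℓ N1T (fun _ hc => N1T_scl hc) (fun _ => N1T_ge) (fun _ _ _ => measurable_N1T) P₀ P₁,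
    generic ℓ N2T (fun _ hc => N2T_scl hc) (fun _ => N2T_ge) (fun _ _ _ => measurable_N2T) P₀ P₁⟩
end

section
/- Let d ≥ 1 and let ℓ : [0,∞) → [0,∞) satisfy (A1,i): ℓ(0) = 0 and ℓ(ru) ≥ rℓ(u) for all r ∈ (0,1), u > 0. Let φ : [0,1] → ℝ^d be absolutely continuous with ‖φ'‖_∞ < ∞. Then N₁(φ') ∫₀¹ ℓ(|φ'(t)|/N₁(φ')) dt ≥ ℓ(|φ(1)−φ(0)|). -/
open MeasureTheory Set Filter
open scoped ENNReal NNReal Classical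

/-- inequality (3.3.0416): under (A1,i), for any absolutely continuous
path on `[0,1]` with essentially bounded derivative `ψ` (so the displacement
`φ(1) - φ(0)` is `∫₀¹ ψ`), one has `N₁(ψ) ∫₀¹ ℓ(|ψ(t)|/N₁(ψ)) dt ≥ ℓ(|φ(1)-φ(0)|)`. -/
theorem statement16 {d : ℕ} (hd : 1 ≤ d) (ℓ : ℝ → ℝ)
    (hℓnn : ∀ u : ℝ, 0 ≤ u → 0 ≤ ℓ u) (hℓ0 : ℓ 0 = 0)
    (hA1i : ∀ r u : ℝ, 0 < r → r < 1 → 0 < u → r * ℓ u ≤ ℓ (r * u))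
    (ψ : ℝ → Vec d) (hψ : Measurable ψ) (hψb : eSup01 ψ < ⊤) :
    ENNReal.ofReal (ℓ ‖∫ s in (0:ℝ)..1, ψ s‖)
      ≤ ∫⁻ t in Icc (0:ℝ) 1, ENNReal.ofReal (N1 ψ * ℓ (‖ψ t‖ / N1 ψ)) := by
  have hle : ∀ᵐ s ∂(volume.restrict (Icc (0:ℝ) 1)), ‖ψ s‖ₑ ≤ eSup01 ψ :=
    ENNReal.ae_le_essSup (fun s => (‖ψ s‖₊ : ℝ≥0∞))
  have hI : (∫ s in (0:ℝ)..1, ψ s) = ∫ s in Icc (0:ℝ) 1, ψ s := by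
    rw [intervalIntegral.integral_of_le zero_le_one, integral_Icc_eq_integral_Ioc]
  by_cases h0 : (∫ s in (0:ℝ)..1, ψ s) = 0
  · simp [h0, hℓ0]
  have hE : ‖∫ s in (0:ℝ)..1, ψ s‖ₑ ≤ ∫⁻ s in Icc (0:ℝ) 1, ‖ψ s‖ₑ := by
    rw [hI]; exact enorm_integral_le_lintegral_enorm _
  have hEM : ‖∫ s in (0:ℝ)..1, ψ s‖ₑ ≤ eSup01 ψ := by
    refine hE.trans ((lintegral_mono_ae hle).trans ?_)
    simp
  have hN : N1 ψ = (eSup01 ψ).toReal / ‖∫ s in (0:ℝ)..1, ψ s‖ := by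
    simp [N1, N1T, h0, eSup01]
  rw [hN]
  generalize (∫ s in (0:ℝ)..1, ψ s) = v at *
  have ha : 0 < ‖v‖ := norm_pos_iff.mpr h0
  have hM : 0 < (eSup01 ψ).toReal := by
    refine ENNReal.toReal_pos ?_ hψb.ne
    intro h
    rw [h] at hEM
    simp at hEM
    exact h0 hEM
  have hle' : ∀ᵐ s ∂(volume.restrict (Icc (0:ℝ) 1)), ‖ψ s‖ ≤ (eSup01 ψ).toReal := by
    filter_upwards [hle] with s hs
    have := ENNReal.toReal_mono hψb.ne hs
    simpa using this
  generalize (eSup01 ψ).toReal = M at *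
  have hc : 0 ≤ ℓ ‖v‖ / ‖v‖ := div_nonneg (hℓnn _ ha.le) ha.le
  calc ENNReal.ofReal (ℓ ‖v‖) = ENNReal.ofReal (ℓ ‖v‖ / ‖v‖) * ‖v‖ₑ := by
        rw [← ofReal_norm, ← ENNReal.ofReal_mul hc, div_mul_cancel₀ _ ha.ne']
    _ ≤ ENNReal.ofReal (ℓ ‖v‖ / ‖v‖) * ∫⁻ s in Icc (0:ℝ) 1, ‖ψ s‖ₑ := by gcongr
    _ = ∫⁻ s in Icc (0:ℝ) 1, ENNReal.ofReal (ℓ ‖v‖ / ‖v‖) * ‖ψ s‖ₑ := by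
        rw [lintegral_const_mul _ hψ.enorm]
    _ ≤ _ := by
        refine lintegral_mono_ae ?_
        filter_upwards [hle'] with s hs
        rw [← ofReal_norm, ← ENNReal.ofReal_mul hc]
        refine ENNReal.ofReal_le_ofReal ?_
        have key : ‖ψ s‖ / M * ℓ ‖v‖ ≤ ℓ (‖ψ s‖ / M * ‖v‖) := by
          rcases (norm_nonneg (ψ s)).eq_or_lt with h | h
          · simp [← h, hℓ0]
          rcases hs.eq_or_lt with h1 | h1
          · simp [h1, hM.ne']
          · exact hA1i _ _ (div_pos h hM) ((div_lt_one hM).mpr h1) ha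
        have e : ‖ψ s‖ / (M / ‖v‖) = ‖ψ s‖ / M * ‖v‖ := by field_simp
        rw [e]
        calc ℓ ‖v‖ / ‖v‖ * ‖ψ s‖ = M / ‖v‖ * (‖ψ s‖ / M * ℓ ‖v‖) := by field_simp
          _ ≤ _ := mul_le_mul_of_nonneg_left key (div_pos hM ha).le
end

section
/- Let d ≥ 1 and let ℓ : [0,∞) → [0,∞) satisfy (A1,i): ℓ(0) = 0 and ℓ(ru) ≥ rℓ(u) for all r ∈ (0,1), u > 0, and (A2,i): ℓ is non-decreasing. Let φ : [0,1] → ℝ^d be absolutely continuous with ‖φ'‖_∞ < ∞. Then N₂(φ') ∫₀¹ ℓ(|φ'(t)|/N₂(φ')) dt ≥ ℓ(‖φ'‖₁) ≥ ℓ(|φ(1)−φ(0)|). -/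
open MeasureTheory Set Filter
open scoped ENNReal NNReal Classical

/-- inequalities (3.15.0427)–(3.16.0427): under (A1,i) and (A2,i), for
any absolutely continuous path on `[0,1]` with essentially bounded derivative `ψ`,
`N₂(ψ) ∫₀¹ ℓ(|ψ(t)|/N₂(ψ)) dt ≥ ℓ(‖ψ‖₁) ≥ ℓ(|φ(1)-φ(0)|)`. -/
theorem statement17 {d : ℕ} (hd : 1 ≤ d) (ℓ : ℝ → ℝ)
    (hℓnn : ∀ u : ℝ, 0 ≤ u → 0 ≤ ℓ u) (hℓ0 : ℓ 0 = 0)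
    (hA1i : ∀ r u : ℝ, 0 < r → r < 1 → 0 < u → r * ℓ u ≤ ℓ (r * u))
    (hA2i : MonotoneOn ℓ (Ici (0:ℝ)))
    (ψ : ℝ → Vec d) (hψ : Measurable ψ) (hψb : eSup01 ψ < ⊤) :
    ENNReal.ofReal (ℓ (∫ s in (0:ℝ)..1, ‖ψ s‖))
      ≤ ∫⁻ t in Icc (0:ℝ) 1, ENNReal.ofReal (N2 ψ * ℓ (‖ψ t‖ / N2 ψ)) ∧
    ℓ ‖∫ s in (0:ℝ)..1, ψ s‖ ≤ ℓ (∫ s in (0:ℝ)..1, ‖ψ s‖) := by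
  have hae : ∀ᵐ t ∂(volume.restrict (Icc (0:ℝ) 1)), ‖ψ t‖ ≤ (eSup01 ψ).toReal := by
    have h := ENNReal.ae_le_essSup (μ := volume.restrict (Icc (0:ℝ) 1))
      (fun s => (‖ψ s‖₊ : ℝ≥0∞))
    filter_upwards [h] with t ht
    have h2 := ENNReal.toReal_mono hψb.ne (show (‖ψ t‖₊ : ℝ≥0∞) ≤ eSup01 ψ from ht)
    simpa using h2
  have hint : IntegrableOn (fun s => ‖ψ s‖) (Icc (0:ℝ) 1) := by
    refine Measure.integrableOn_of_bounded (M := (eSup01 ψ).toReal) (by simp)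
      hψ.norm.aestronglyMeasurable ?_
    filter_upwards [hae] with t ht
    simpa using ht
  have hIeq : (∫ s in (0:ℝ)..1, ‖ψ s‖) = ∫ s in Icc (0:ℝ) 1, ‖ψ s‖ := by
    rw [intervalIntegral.integral_of_le zero_le_one, integral_Icc_eq_integral_Ioc]
  have hI0 : 0 ≤ ∫ s in (0:ℝ)..1, ‖ψ s‖ :=
    intervalIntegral.integral_nonneg zero_le_one (fun _ _ => norm_nonneg _)
  refine ⟨?_, hA2i (norm_nonneg _) hI0
    (intervalIntegral.norm_integral_le_integral_norm zero_le_one)⟩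
  rcases hI0.eq_or_lt with h0 | hpos
  · rw [← h0, hℓ0]; simp
  have hN : N2 ψ = (eSup01 ψ).toReal / (∫ s in (0:ℝ)..1, ‖ψ s‖) := by
    simp only [N2, N2T, if_pos hpos, one_mul, eSup01]
  set M := (eSup01 ψ).toReal with hM
  set I := ∫ s in (0:ℝ)..1, ‖ψ s‖ with hI
  have hM0 : 0 < M := by
    rcases (ENNReal.toReal_nonneg : 0 ≤ M).eq_or_lt with h | h
    · exfalso
      have : I = 0 := by
        rw [hIeq]
        refine integral_eq_zero_of_ae ?_
        filter_upwards [hae] with t ht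
        exact le_antisymm (ht.trans h.symm.le) (norm_nonneg _)
      exact hpos.ne' this
    · exact h
  rw [hN]
  have hkey : ENNReal.ofReal (ℓ I) =
      ∫⁻ t in Icc (0:ℝ) 1, ENNReal.ofReal (‖ψ t‖ * (ℓ I / I)) := by
    rw [← ofReal_integral_eq_lintegral_ofReal (hint.mul_const _)
      (Eventually.of_forall fun t =>
        mul_nonneg (norm_nonneg _) (div_nonneg (hℓnn _ hI0) hI0)),
      integral_mul_const, ← hIeq]
    congr 1
    field_simp
  rw [hkey]
  refine lintegral_mono_ae ?_
  filter_upwards [hae] with t ht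
  refine ENNReal.ofReal_le_ofReal ?_
  have hx : ‖ψ t‖ / (M / I) = ‖ψ t‖ / M * I := by field_simp
  have hr : ‖ψ t‖ / M * ℓ I ≤ ℓ (‖ψ t‖ / M * I) := by
    rcases (norm_nonneg (ψ t)).eq_or_lt with h | h
    · simp [← h, hℓ0]
    rcases ht.eq_or_lt with h1 | h1
    · rw [h1, div_self hM0.ne', one_mul, one_mul]
    · exact hA1i _ _ (div_pos h hM0) ((div_lt_one hM0).2 h1) hpos
  rw [hx]
  calc ‖ψ t‖ * (ℓ I / I) = M / I * (‖ψ t‖ / M * ℓ I) := by field_simp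
    _ ≤ _ := mul_le_mul_of_nonneg_left hr (div_pos hM0 hpos).le
end
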